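/- arXiv:1611.02070 — 3 statements merged into one kernel-verified Lean document; each statement's English description precedes it below -/
import Mathlib

section
/- Let (a,b) and (c,d) be arcs in 𝒜 such that the condition a < c ≤ b < d does NOT hold. Then every short exact sequence of graded S-modules with degree-0 maps 0 → M_{(a,b)} → B → M_{(c,d)} → 0 splits, i.e. B is isomorphic to M_{(a,b)} ⊕ M_{(c,d)} via a degree-0 isomorphism compatible with the sequence. -/
/-- `𝒵 = ℤ ∪ {−∞}`. -/
abbrev Zb := WithBot ℤ

universe u

noncomputable section

/-- A `ℤ`-graded module over `S = k[y]` (`y` of degree `1`), presented as a representation of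
the companion category: a family of `k`-vector spaces `V i` (the degree-`i` homogeneous
components) together with the action of `y`, raising degrees by one. -/
structure GrMod (k : Type u) [Field k] where
  V : ℤ → Type u
  [acg : ∀ i, AddCommGroup (V i)]
  [mod : ∀ i, Module k (V i)]
  act : ∀ i, V i →ₗ[k] V (i + 1)

attribute [instance] GrMod.acg GrMod.mod

variable (k : Type u) [Field k]

/-- The degree-`i` component of the graded module `M_{(a,b)}` attached to a pair `(a,b)`:
it is `k` when `a < −i ≤ b` and `0` otherwise.  (For an arc `a < b` with `a,b ∈ ℤ` this is
the module `S/(y^{b−a})(b)`, generated in degree `−b`; for `a = −∞` it is `S(b)`; if `a = b`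
it is the zero module.) -/
def arcComp (a b : Zb) (i : ℤ) : Submodule k k :=
  if a < ((-i : ℤ) : Zb) ∧ ((-i : ℤ) : Zb) ≤ b then ⊤ else ⊥

/-- The graded module `M_{(a,b)}`: for integers `a < b` this is `S/(y^{b−a})(b)`, for
`a = −∞` it is the twisted free module `S(b)`, and for `a = b` it is the zero module.
The action of `y` is the canonical one (the identity of `k` whenever source and target
components are both nonzero). -/
def arcMod (a b : Zb) : GrMod k where
  V i := ↥(arcComp k a b i)
  act i := by
    classical
    exact if h : arcComp k a b (i + 1) = ⊤ then
      LinearMap.codRestrict _ (arcComp k a b i).subtype (fun x => by rw [h]; trivial)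
    else 0

/-- A family of degree-wise linear maps is a (degree-0) morphism of graded modules if it
commutes with the action of `y`. -/
def IsGrHom (M N : GrMod k) (f : ∀ i, M.V i →ₗ[k] N.V i) : Prop :=
  ∀ i, (N.act i).comp (f i) = (f (i + 1)).comp (M.act i)

/-- The `k`-vector space `Hom_{gr S}(M, N)` of degree-0 graded module homomorphisms. -/
def grHom (M N : GrMod k) : Submodule k (∀ i, M.V i →ₗ[k] N.V i) where
  carrier := {f | IsGrHom k M N f}
  add_mem' := by
    intro f g hf hg i
    simp only [Pi.add_apply, LinearMap.comp_add, LinearMap.add_comp, hf i, hg i]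
  zero_mem' := by
    intro i
    simp only [Pi.zero_apply, LinearMap.comp_zero, LinearMap.zero_comp]
  smul_mem' := by
    intro c f hf i
    simp only [Pi.smul_apply, LinearMap.comp_smul, LinearMap.smul_comp, hf i]

/-- An isomorphism of graded modules: a family of degree-wise linear equivalences commuting
with the action of `y`. -/
structure GrIso (M N : GrMod k) where
  e : ∀ i, M.V i ≃ₗ[k] N.V i
  comm : ∀ (i : ℤ) (x : M.V i), N.act i (e i x) = e (i + 1) (M.act i x)

/-- The kernel of a morphism of graded modules, as a graded module. -/
def kerMod (M N : GrMod k) (f : ∀ i, M.V i →ₗ[k] N.V i) (hf : IsGrHom k M N f) : GrMod k where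
  V i := ↥(LinearMap.ker (f i))
  act i := (M.act i).restrict (p := LinearMap.ker (f i)) (q := LinearMap.ker (f (i + 1)))
    (fun x hx => by
      have h := LinearMap.congr_fun (hf i) x
      simp only [LinearMap.comp_apply] at h
      simp only [LinearMap.mem_ker] at hx ⊢
      rw [← h, hx, map_zero])

/-- The cokernel of a morphism of graded modules, as a graded module. -/
def cokerMod (M N : GrMod k) (f : ∀ i, M.V i →ₗ[k] N.V i) (hf : IsGrHom k M N f) : GrMod k where
  V i := N.V i ⧸ LinearMap.range (f i)
  act i := Submodule.mapQ _ _ (N.act i) (by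
    rintro x hx
    simp only [LinearMap.mem_range] at hx
    obtain ⟨y, rfl⟩ := hx
    simp only [Submodule.mem_comap, LinearMap.mem_range]
    have h := LinearMap.congr_fun (hf i) y
    simp only [LinearMap.comp_apply] at h
    exact ⟨M.act i y, h.symm⟩)

/-- The direct sum of two graded modules. -/
def dsumMod (M N : GrMod k) : GrMod k where
  V i := M.V i × N.V i
  act i := (M.act i).prodMap (N.act i)

/-- `0 → M → B → N → 0` is a short exact sequence of graded modules (with degree-0 maps). -/
def IsGrSES (M B N : GrMod k) (ι : ∀ i, M.V i →ₗ[k] B.V i)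
    (π : ∀ i, B.V i →ₗ[k] N.V i) : Prop :=
  IsGrHom k M B ι ∧ IsGrHom k B N π ∧
    ∀ i, Function.Injective (ι i) ∧ Function.Surjective (π i) ∧
      LinearMap.ker (π i) = LinearMap.range (ι i)

/-- A short exact sequence of graded modules splits if the projection admits a degree-0
graded section. -/
def GrSplit (M B N : GrMod k) (ι : ∀ i, M.V i →ₗ[k] B.V i)
    (π : ∀ i, B.V i →ₗ[k] N.V i) : Prop :=
  ∃ σ : ∀ i, N.V i →ₗ[k] B.V i, IsGrHom k N B σ ∧ ∀ i, (π i).comp (σ i) = LinearMap.id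

end

/-- The degree `i` lies in the support of `M_{(a,b)}`. -/
def InArc (a b : Zb) (i : ℤ) : Prop :=
  a < ((-i : ℤ) : Zb) ∧ ((-i : ℤ) : Zb) ≤ b

/-- The underlying scalar of a homogeneous element of `M_{(a,b)}`. -/
noncomputable def arcVal (k : Type u) [Field k] (a b : Zb) (i : ℤ) : (arcMod k a b).V i →ₗ[k] k :=
  (arcComp k a b i).subtype

section ArcMod

variable {k : Type u} [Field k] {a b : Zb} {i : ℤ}

theorem arcVal_injective : Function.Injective (arcVal k a b i) :=
  Subtype.val_injective

theorem arcComp_eq_top (h : InArc a b i) : arcComp k a b i = ⊤ := if_pos h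

theorem arcComp_eq_bot (h : ¬InArc a b i) : arcComp k a b i = ⊥ := if_neg h

theorem arcMod_eq_zero (h : ¬InArc a b i) (x : (arcMod k a b).V i) : x = 0 := by
  apply arcVal_injective
  have hx : arcVal k a b i x ∈ arcComp k a b i := Subtype.property x
  rw [arcComp_eq_bot h, Submodule.mem_bot] at hx
  rw [hx, map_zero]

theorem exists_arcVal_eq (h : InArc a b i) (r : k) :
    ∃ x : (arcMod k a b).V i, arcVal k a b i x = r :=
  ⟨⟨r, by rw [arcComp_eq_top h]; trivial⟩, rfl⟩

theorem arcVal_act (h : InArc a b (i + 1)) (x : (arcMod k a b).V i) :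
    arcVal k a b (i + 1) ((arcMod k a b).act i x) = arcVal k a b i x := by
  simp only [arcMod, dif_pos (arcComp_eq_top (k := k) h)]
  rfl

end ArcMod

/-- A homogeneous element extends to a family of elements, compatible with the action of `y`
in all higher degrees. -/
theorem GrMod.exists_orbit {k : Type u} [Field k] (B : GrMod k) (j : ℤ) (g : B.V j) :
    ∃ s : ∀ i, B.V i, s j = g ∧ ∀ i, j ≤ i → B.act i (s i) = s (i + 1) := by
  refine ⟨fun i => Int.inductionOn' (motive := B.V) i j g (fun n _ x => B.act n x)
    (fun _ _ _ => 0), ?_, fun i hi => ?_⟩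
  · exact Int.inductionOn'_self ..
  · exact (Int.inductionOn'_add_one hi).symm

/-- A section of a surjection onto `M_{(c,d)}` is determined by a compatible family of lifts of
the basis elements of the homogeneous components. -/
theorem grSplit_of_lifts {k : Type u} [Field k] {c d : Zb} {M B : GrMod k}
    (ι : ∀ i, M.V i →ₗ[k] B.V i) (π : ∀ i, B.V i →ₗ[k] (arcMod k c d).V i) (s : ∀ i, B.V i)
    (hval : ∀ i, InArc c d i → arcVal k c d i (π i (s i)) = 1)
    (hact : ∀ i, InArc c d i → InArc c d (i + 1) → B.act i (s i) = s (i + 1))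
    (hend : ∀ i, InArc c d i → ¬InArc c d (i + 1) → B.act i (s i) = 0) :
    GrSplit k M B (arcMod k c d) ι π := by
  refine ⟨fun i => (arcVal k c d i).smulRight (s i), fun i => ?_, fun i => ?_⟩
  · ext x
    simp only [LinearMap.comp_apply, LinearMap.smulRight_apply, map_smul]
    by_cases hi : InArc c d i
    · by_cases hi' : InArc c d (i + 1)
      · rw [arcVal_act hi', hact i hi hi']
      · rw [hend i hi hi', arcMod_eq_zero hi' ((arcMod k c d).act i x), map_zero, smul_zero,
          zero_smul]
    · rw [arcMod_eq_zero hi x]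
      simp only [map_zero, zero_smul]
  · ext x
    by_cases hi : InArc c d i
    · apply arcVal_injective
      simp [hval i hi]
    · rw [arcMod_eq_zero hi x, map_zero, map_zero]

/-- A split short exact sequence identifies the middle term with the direct sum. -/
theorem GrSplit.exists_grIso {k : Type u} [Field k] {M B N : GrMod k}
    {ι : ∀ i, M.V i →ₗ[k] B.V i} {π : ∀ i, B.V i →ₗ[k] N.V i}
    (hses : IsGrSES k M B N ι π) (hsplit : GrSplit k M B N ι π) :
    ∃ e : GrIso k B (dsumMod k M N),
      (∀ (i : ℤ) (x : M.V i), e.e i (ι i x) = (x, 0)) ∧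
      (∀ (i : ℤ) (y : B.V i), π i y = (e.e i y).2) := by
  obtain ⟨hι, hπ, hex⟩ := hses
  obtain ⟨σ, hσ, hπσ⟩ := hsplit
  have hπσ' (i : ℤ) (z : N.V i) : π i (σ i z) = z := LinearMap.congr_fun (hπσ i) z
  have hπι (i : ℤ) (x : M.V i) : π i (ι i x) = 0 := by
    rw [← LinearMap.mem_ker, (hex i).2.2]
    exact ⟨x, rfl⟩
  have hbij (i : ℤ) : Function.Bijective ((ι i).coprod (σ i)) := by
    constructor
    · rw [injective_iff_map_eq_zero]
      rintro ⟨x, z⟩ h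
      rw [LinearMap.coprod_apply] at h
      have hz : z = 0 := by simpa [hπι, hπσ'] using congrArg (π i) h
      subst hz
      rw [map_zero, add_zero] at h
      have hx : x = 0 := (map_eq_zero_iff _ (hex i).1).1 h
      rw [hx, Prod.mk_zero_zero]
    · intro y
      have hy : y - σ i (π i y) ∈ LinearMap.ker (π i) := by simp [hπσ']
      rw [(hex i).2.2] at hy
      obtain ⟨x, hx⟩ := hy
      exact ⟨(x, π i y), by simp [hx]⟩
  let f (i : ℤ) : (M.V i × N.V i) ≃ₗ[k] B.V i :=
    LinearEquiv.ofBijective ((ι i).coprod (σ i)) (hbij i)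
  have hf (i : ℤ) (x : M.V i) (z : N.V i) : f i (x, z) = ι i x + σ i z := rfl
  refine ⟨⟨fun i => (f i).symm, fun i y => ?_⟩, fun i x => ?_, fun i y => ?_⟩
  · obtain ⟨⟨x, z⟩, rfl⟩ := (f i).surjective y
    change (M.act i).prodMap (N.act i) ((f i).symm (f i (x, z))) = (f (i + 1)).symm _
    rw [LinearEquiv.symm_apply_apply, LinearEquiv.eq_symm_apply, LinearMap.prodMap_apply, hf, hf,
      map_add]
    exact congrArg₂ _ (LinearMap.congr_fun (hι i) x).symm (LinearMap.congr_fun (hσ i) z).symm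
  · change (f i).symm (ι i x) = (x, 0)
    rw [LinearEquiv.symm_apply_eq, hf, map_zero, add_zero]
  · obtain ⟨⟨x, z⟩, rfl⟩ := (f i).surjective y
    change _ = ((f i).symm (f i (x, z))).2
    rw [LinearEquiv.symm_apply_apply, hf, map_add, hπι, hπσ', zero_add]

/-- The extension of `M_{(c,d)}` by `M_{(a,b)}` splits when every element of `M_{(a,b)}` in the
degree `-c` of the relation is a multiple of one in the degree `-d` of the generator. -/
theorem grSplit_arcMod {k : Type u} [Field k] {a b c d : Zb} (hcd : c < d)
    (hncfg : ¬(a < c ∧ c ≤ b ∧ b < d)) {B : GrMod k}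
    {ι : ∀ i, (arcMod k a b).V i →ₗ[k] B.V i} {π : ∀ i, B.V i →ₗ[k] (arcMod k c d).V i}
    (hses : IsGrSES k (arcMod k a b) B (arcMod k c d) ι π) :
    GrSplit k (arcMod k a b) B (arcMod k c d) ι π := by
  obtain ⟨hι, hπ, hex⟩ := hses
  obtain ⟨d, rfl⟩ := WithBot.ne_bot_iff_exists.1 hcd.ne_bot
  have hgen : InArc c (d : Zb) (-d) := by simpa [InArc] using hcd
  obtain ⟨u, hu⟩ := exists_arcVal_eq hgen (1 : k)
  obtain ⟨g, rfl⟩ := (hex (-d)).2.1 u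
  obtain ⟨s, rfl, hs⟩ := B.exists_orbit (-d) g
  have hle {i : ℤ} (hi : InArc c (d : Zb) i) : -d ≤ i := by
    have := WithBot.coe_le_coe.1 hi.2
    lia
  have hval (i : ℤ) (hi : InArc c (d : Zb) i) : arcVal k c d i (π i (s i)) = 1 := by
    have key : ∀ i, -d ≤ i → InArc c (d : Zb) i → arcVal k c d i (π i (s i)) = 1 := by
      intro i hi
      induction i, hi using Int.leInduction with
      | base => exact fun _ => hu
      | succ n hn ih =>
        intro hn'
        have hc : InArc c (d : Zb) n :=
          ⟨hn'.1.trans (WithBot.coe_lt_coe.2 (by lia)), WithBot.coe_le_coe.2 (by lia)⟩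
        rw [← hs n hn, ← ih hc, ← arcVal_act hn']
        exact congrArg _ (LinearMap.congr_fun (hπ n) (s n)).symm
    exact key i (hle hi) hi
  induction c using WithBot.recBotCoe with
  | bot =>
    refine grSplit_of_lifts ι π s hval (fun i hi _ => hs i (hle hi)) fun i hi hi' => ?_
    have := hle hi
    exact absurd ⟨WithBot.bot_lt_coe _, WithBot.coe_le_coe.2 (by lia)⟩ hi'
  | coe c =>
    have hin (i : ℤ) : InArc (c : Zb) (d : Zb) i ↔ -d ≤ i ∧ i < -c := by
      simp only [InArc, WithBot.coe_lt_coe, WithBot.coe_le_coe]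
      lia
    have hcd' : c < d := WithBot.coe_lt_coe.1 hcd
    have hker : s (-c) ∈ LinearMap.ker (π (-c)) :=
      arcMod_eq_zero (by rw [hin]; lia) _
    rw [(hex (-c)).2.2] at hker
    obtain ⟨m, hm⟩ := hker
    obtain ⟨t, ht, htm⟩ : ∃ t : ∀ i, (arcMod k a b).V i,
        (∀ i, -d ≤ i → i < -c → (arcMod k a b).act i (t i) = t (i + 1)) ∧ t (-c) = m := by
      by_cases hc : InArc a b (-c)
      · have hc' : a < (c : Zb) ∧ (c : Zb) ≤ b := by simpa [InArc] using hc
        have hdb : (d : Zb) ≤ b := by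
          by_contra h
          exact hncfg ⟨hc'.1, hc'.2, not_le.1 h⟩
        have hsupp (i : ℤ) (h₁ : -d ≤ i) (h₂ : i ≤ -c) : InArc a b i :=
          ⟨hc'.1.trans_le (WithBot.coe_le_coe.2 (by lia)),
            (WithBot.coe_le_coe.2 (by lia)).trans hdb⟩
        have hex' (i : ℤ) : ∃ x : (arcMod k a b).V i,
            InArc a b i → arcVal k a b i x = arcVal k a b (-c) m := by
          by_cases hi : InArc a b i
          · obtain ⟨x, hx⟩ := exists_arcVal_eq hi (arcVal k a b (-c) m)
            exact ⟨x, fun _ => hx⟩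
          · exact ⟨0, fun h => absurd h hi⟩
        choose t ht using hex'
        refine ⟨t, fun i h₁ h₂ => arcVal_injective ?_, arcVal_injective (ht _ hc)⟩
        have hi' := hsupp (i + 1) (by lia) (by lia)
        rw [arcVal_act hi', ht _ hi', ht _ (hsupp i h₁ h₂.le)]
      · exact ⟨fun _ => 0, fun _ _ _ => map_zero _, (arcMod_eq_zero hc m).symm⟩
    have hact (i : ℤ) (h₁ : -d ≤ i) (h₂ : i < -c) :
        B.act i (s i - ι i (t i)) = s (i + 1) - ι (i + 1) (t (i + 1)) := by
      rw [map_sub, hs i h₁, ← ht i h₁ h₂]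
      exact congrArg _ (LinearMap.congr_fun (hι i) (t i))
    refine grSplit_of_lifts ι π (fun i => s i - ι i (t i)) (fun i hi => ?_)
      (fun i hi _ => hact i ((hin i).1 hi).1 ((hin i).1 hi).2) fun i hi hi' => ?_
    · have h0 : π i (ι i (t i)) = 0 := by
        rw [← LinearMap.mem_ker, (hex i).2.2]
        exact ⟨_, rfl⟩
      rw [map_sub, h0, sub_zero, hval i hi]
    · rw [hin] at hi hi'
      rw [hact i hi.1 hi.2]
      obtain rfl : i = -c - 1 := by lia
      rw [sub_add_cancel, htm, hm, sub_self]

/-- For arcs `(a,b)` and `(c,d)` for which `a < c ≤ b < d` does NOT hold,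
every short exact sequence of graded `S`-modules `0 → M_{(a,b)} → B → M_{(c,d)} → 0` splits:
`B` is isomorphic to `M_{(a,b)} ⊕ M_{(c,d)}` via a degree-0 isomorphism compatible with the
sequence. -/
theorem stmt3 (k : Type u) [Field k] (a b c d : Zb) (hab : a < b) (hcd : c < d)
    (hncfg : ¬(a < c ∧ c ≤ b ∧ b < d))
    (B : GrMod k) (ι : ∀ i, (arcMod k a b).V i →ₗ[k] B.V i)
    (π : ∀ i, B.V i →ₗ[k] (arcMod k c d).V i)
    (hses : IsGrSES k (arcMod k a b) B (arcMod k c d) ι π) :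
    GrSplit k (arcMod k a b) B (arcMod k c d) ι π ∧
    ∃ e : GrIso k B (dsumMod k (arcMod k a b) (arcMod k c d)),
      (∀ (i : ℤ) (x : (arcMod k a b).V i), e.e i (ι i x) = (x, 0)) ∧
      (∀ (i : ℤ) (y : B.V i), π i y = (e.e i y).2) := by
  have hsplit := grSplit_arcMod hcd hncfg hses
  exact ⟨hsplit, hsplit.exists_grIso hses⟩
end

section
/- Let k be a field and S = k[y] the ℤ-graded polynomial ring with y in degree 1. Every nonzero finitely generated indecomposable ℤ-graded S-module is isomorphic, via a degree-preserving S-linear isomorphism, either to the twisted free module S(j) for some j ∈ ℤ, or to the twisted cyclic module S/(y^i)(j) for some i ≥ 1 and j ∈ ℤ. Moreover, no two of these modules corresponding to distinct arcs are isomorphic via a degree-preserving isomorphism, so the isomorphism classes of finitely generated indecomposable graded S-modules are in bijection with the set 𝒜 of arcs. -/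
universe u

variable (k : Type u) [Field k]

/-- A graded submodule of a graded module: a family of subspaces closed under the action
of `y`. -/
structure SubRep (M : GrMod k) where
  P : ∀ i, Submodule k (M.V i)
  act_mem : ∀ (i : ℤ), ∀ x ∈ P i, M.act i x ∈ P (i + 1)

/-- A graded module is nonzero if some homogeneous component has a nonzero element. -/
def GrNonzero (M : GrMod k) : Prop := ∃ (i : ℤ) (x : M.V i), x ≠ 0

/-- A graded module is finitely generated if there is a finite set of homogeneous elements
contained in no proper graded submodule. -/
def GrFG (M : GrMod k) : Prop :=
  ∃ s : Finset ((i : ℤ) × M.V i), ∀ N : SubRep k M,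
    (∀ p ∈ s, p.2 ∈ N.P p.1) → ∀ i, N.P i = ⊤

/-- A graded module is indecomposable if it is nonzero and is not the (internal) direct sum
of two nonzero graded submodules. -/
def GrIndec (M : GrMod k) : Prop :=
  GrNonzero k M ∧ ¬ ∃ P Q : SubRep k M,
    (∃ i, P.P i ≠ ⊥) ∧ (∃ i, Q.P i ≠ ⊥) ∧ ∀ i, IsCompl (P.P i) (Q.P i)

namespace GrMod

variable {k}

/-- The action of `y` on the total space `⨁ i, M.V i`. -/
noncomputable def shift (M : GrMod k) : Module.End k (DirectSum ℤ M.V) :=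
  DirectSum.toModule k ℤ _ fun i => (DirectSum.lof k ℤ M.V (i + 1)).comp (M.act i)

theorem shift_lof (M : GrMod k) (i : ℤ) (x : M.V i) :
    M.shift (DirectSum.lof k ℤ M.V i x) = DirectSum.lof k ℤ M.V (i + 1) (M.act i x) := by
  simp [shift, DirectSum.toModule_lof]

theorem component_shift (M : GrMod k) (i : ℤ) (w : DirectSum ℤ M.V) :
    DirectSum.component k ℤ M.V (i + 1) (M.shift w) =
      M.act i (DirectSum.component k ℤ M.V i w) := by
  suffices h : (DirectSum.component k ℤ M.V (i + 1)).comp M.shift =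
      (M.act i).comp (DirectSum.component k ℤ M.V i) from LinearMap.congr_fun h w
  refine DirectSum.linearMap_ext k fun j => LinearMap.ext fun x => ?_
  simp only [LinearMap.comp_apply, shift_lof]
  by_cases h : j = i
  · subst h
    rw [DirectSum.component.lof_self, DirectSum.component.lof_self]
  · rw [DirectSum.component.of, DirectSum.component.of, dif_neg h, dif_neg (by omega), map_zero]

/-- The map `⨁ i, M.V i → M.V m` sending a component of degree `i ≤ m` into degree `m` by
multiplication by `y ^ (m - i)`, and the components of degree `> m` to zero. -/
noncomputable def pushTo (M : GrMod k) (m : ℤ) : DirectSum ℤ M.V →ₗ[k] M.V m :=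
  DirectSum.toModule k ℤ _ fun i =>
    if i ≤ m then
      (DirectSum.component k ℤ M.V m).comp
        ((M.shift ^ (m - i).toNat).comp (DirectSum.lof k ℤ M.V i))
    else 0

theorem pushTo_lof (M : GrMod k) {i m : ℤ} (h : i ≤ m) (x : M.V i) :
    M.pushTo m (DirectSum.lof k ℤ M.V i x) =
      DirectSum.component k ℤ M.V m ((M.shift ^ (m - i).toNat) (DirectSum.lof k ℤ M.V i x)) := by
  simp [pushTo, DirectSum.toModule_lof, h]

theorem pushTo_lof_act (M : GrMod k) {i m : ℤ} (h : i + 1 ≤ m) (x : M.V i) :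
    M.pushTo m (DirectSum.lof k ℤ M.V (i + 1) (M.act i x)) =
      M.pushTo m (DirectSum.lof k ℤ M.V i x) := by
  have hn : (m - i).toNat = (m - (i + 1)).toNat + 1 := by omega
  rw [pushTo_lof M h, pushTo_lof M (by omega : i ≤ m), hn, pow_succ, Module.End.mul_apply,
    shift_lof]

/-- The orbit of `v` under `y`: its member of degree `i` is `y ^ (i - d) v` for `i ≥ d`. -/
noncomputable def orbit (M : GrMod k) {d : ℤ} (v : M.V d) (i : ℤ) : M.V i :=
  DirectSum.component k ℤ M.V i ((M.shift ^ (i - d).toNat) (DirectSum.lof k ℤ M.V d v))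

theorem orbit_self (M : GrMod k) {d : ℤ} (v : M.V d) : M.orbit v d = v := by
  simp [orbit, DirectSum.component.lof_self]

theorem act_orbit (M : GrMod k) {d : ℤ} (v : M.V d) {i : ℤ} (h : d ≤ i) :
    M.act i (M.orbit v i) = M.orbit v (i + 1) := by
  have hn : (i + 1 - d).toNat = (i - d).toNat + 1 := by omega
  rw [orbit, orbit, hn, pow_succ', Module.End.mul_apply, component_shift]

theorem orbit_ne_zero_of_le (M : GrMod k) {d : ℤ} (v : M.V d) {i j : ℤ} (hi : d ≤ i)
    (hij : i ≤ j) (hj : M.orbit v j ≠ 0) : M.orbit v i ≠ 0 := by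
  induction j, hij using Int.leInduction with
  | base => exact hj
  | succ n hn ih =>
    refine ih fun h => hj ?_
    rw [← act_orbit M v (hi.trans hn), h, map_zero]

/-- The relations `y x = x`, for `x` in a degree `i` such that `y ^ (i + 1 - d) v ≠ 0`. -/
def orbitRel (M : GrMod k) {d : ℤ} (v : M.V d) : Submodule k (DirectSum ℤ M.V) :=
  Submodule.span k {w | ∃ (i : ℤ) (x : M.V i), M.orbit v (i + 1) ≠ 0 ∧
    w = DirectSum.lof k ℤ M.V (i + 1) (M.act i x) - DirectSum.lof k ℤ M.V i x}

theorem lof_notMem_orbitRel (M : GrMod k) {d : ℤ} (v : M.V d) (hv : v ≠ 0)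
    (hd : ∀ i < d, ∀ x : M.V i, x = 0) :
    DirectSum.lof k ℤ M.V d v ∉ M.orbitRel v := by
  have ne_zero_le : ∀ i, M.orbit v i ≠ 0 → d ≤ i := fun i hi =>
    le_of_not_gt fun h => hi (hd i h _)
  have key : ∀ w ∈ M.orbitRel v, ∃ m₀, M.orbit v m₀ ≠ 0 ∧
      ∀ m, m₀ ≤ m → M.pushTo m w = 0 := by
    intro w hw
    induction hw using Submodule.span_induction with
    | mem w hw =>
      obtain ⟨i, x, hi, rfl⟩ := hw
      exact ⟨i + 1, hi, fun m hm => by rw [map_sub, pushTo_lof_act M hm, sub_self]⟩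
    | zero => exact ⟨d, by rwa [orbit_self], fun m _ => map_zero _⟩
    | add w₁ w₂ _ _ h₁ h₂ =>
      obtain ⟨m₁, hm₁, h₁⟩ := h₁
      obtain ⟨m₂, hm₂, h₂⟩ := h₂
      refine ⟨max m₁ m₂, ?_, fun m hm => ?_⟩
      · rcases max_choice m₁ m₂ with h | h <;> rwa [h]
      · rw [map_add, h₁ m ((le_max_left _ _).trans hm), h₂ m ((le_max_right _ _).trans hm),
          add_zero]
    | smul c w _ h =>
      obtain ⟨m₀, hm₀, h⟩ := h
      exact ⟨m₀, hm₀, fun m hm => by rw [map_smul, h m hm, smul_zero]⟩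
  intro hmem
  obtain ⟨m, hm, h⟩ := key _ hmem
  exact hm (by rw [orbit, ← pushTo_lof M (ne_zero_le m hm), h m le_rfl])

/-- A nonzero element of lowest degree generates a direct summand: there is a retraction onto
its orbit. -/
theorem exists_retraction (M : GrMod k) {d : ℤ} (v : M.V d) (hv : v ≠ 0)
    (hd : ∀ i < d, ∀ x : M.V i, x = 0) :
    ∃ r : ∀ i, M.V i →ₗ[k] k,
      (∀ i, M.orbit v i ≠ 0 → r i (M.orbit v i) = 1) ∧
      (∀ i, M.orbit v i = 0 → r i = 0) ∧
      ∀ i, M.orbit v (i + 1) ≠ 0 → ∀ x, r (i + 1) (M.act i x) = r i x := by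
  classical
  have ne_zero_le : ∀ i, M.orbit v i ≠ 0 → d ≤ i := fun i hi =>
    le_of_not_gt fun h => hi (hd i h _)
  obtain ⟨f, hf, hker⟩ := Submodule.exists_le_ker_of_notMem (lof_notMem_orbitRel M v hv hd)
  set c := f (DirectSum.lof k ℤ M.V d v)
  have hstep : ∀ i, M.orbit v (i + 1) ≠ 0 → ∀ x,
      f (DirectSum.lof k ℤ M.V (i + 1) (M.act i x)) = f (DirectSum.lof k ℤ M.V i x) := by
    intro i hi x
    have h := hker (Submodule.subset_span ⟨i, x, hi, rfl⟩)
    rwa [LinearMap.mem_ker, map_sub, sub_eq_zero] at h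
  have hconst : ∀ i, d ≤ i → M.orbit v i ≠ 0 →
      f (DirectSum.lof k ℤ M.V i (M.orbit v i)) = c := by
    intro i hi
    induction i, hi using Int.leInduction with
    | base => intro; rw [orbit_self]
    | succ n hn ih =>
      intro h
      rw [← act_orbit M v hn, hstep n h,
        ih (orbit_ne_zero_of_le M v hn (by omega) h)]
  refine ⟨fun i => if M.orbit v i = 0 then 0 else c⁻¹ • f.comp (DirectSum.lof k ℤ M.V i),
    fun i hi => ?_, fun i hi => if_pos hi, fun i hi x => ?_⟩
  · simp [hi, hconst i (ne_zero_le i hi) hi, hf]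
  · by_cases h : M.orbit v i = 0
    · have hid : i < d := lt_of_not_ge fun hle => hi (by rw [← act_orbit M v hle, h, map_zero])
      rw [hd i hid x, map_zero, map_zero, map_zero]
    · simp [hi, h, hstep i hi x]

end GrMod

variable {k} in
/-- A finitely generated graded module is bounded below. -/
theorem GrFG.exists_forall_lt_eq_zero {M : GrMod k} (hM : GrFG k M) :
    ∃ m : ℤ, ∀ i < m, ∀ x : M.V i, x = 0 := by
  classical
  obtain ⟨s, hs⟩ := hM
  obtain ⟨m, hm⟩ := (s.image Sigma.fst).bddBelow
  let N : SubRep k M :=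
    { P := fun i => if m ≤ i then ⊤ else ⊥
      act_mem := fun i x hx => by
        by_cases h : m ≤ i
        · simp [show m ≤ i + 1 by omega]
        · rw [if_neg h, Submodule.mem_bot] at hx
          simp [hx] }
  have hN := hs N fun p hp => by
    have h : m ≤ p.1 := hm (Finset.mem_coe.2 (Finset.mem_image_of_mem _ hp))
    simp [N, h]
  refine ⟨m, fun i hi x => ?_⟩
  have hx : x ∈ N.P i := by rw [hN i]; trivial
  simpa [N, not_le.2 hi] using hx

theorem mem_arcComp {a b : Zb} {i : ℤ} {c : k} :
    c ∈ arcComp k a b i ↔ c = 0 ∨ a < ((-i : ℤ) : Zb) ∧ ((-i : ℤ) : Zb) ≤ b := by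
  unfold arcComp
  split_ifs with h <;> simp [h]

theorem arcComp_eq_top_iff {a b : Zb} {i : ℤ} :
    arcComp k a b i = ⊤ ↔ a < ((-i : ℤ) : Zb) ∧ ((-i : ℤ) : Zb) ≤ b := by
  unfold arcComp
  split_ifs with h <;> simp [h, bot_ne_top]

theorem arcMod_act_coe {a b : Zb} {i : ℤ} (h : arcComp k a b (i + 1) = ⊤)
    (x : arcComp k a b i) :
    (arcComp k a b (i + 1)).subtype ((arcMod k a b).act i x) = x := by
  have hact : (arcMod k a b).act i = LinearMap.codRestrict (arcComp k a b (i + 1))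
      (arcComp k a b i).subtype (fun x => by rw [h]; trivial) := dif_pos h
  rw [hact]
  rfl

theorem arcMod_act_eq_zero {a b : Zb} {i : ℤ} (h : arcComp k a b (i + 1) ≠ ⊤) :
    (arcMod k a b).act i = 0 :=
  dif_neg h

variable {k} in
/-- The degrees in which the orbit of a nonzero element of lowest degree does not vanish are those
of the support of `M_{(a,b)}` for some arc `(a,b)`. -/
theorem GrMod.exists_arc_orbit (M : GrMod k) {d : ℤ} (v : M.V d) (hv : v ≠ 0)
    (hd : ∀ i < d, ∀ x : M.V i, x = 0) :
    ∃ a b : Zb, a < b ∧ ∀ i : ℤ,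
      (a < ((-i : ℤ) : Zb) ∧ ((-i : ℤ) : Zb) ≤ b) ↔ M.orbit v i ≠ 0 := by
  have ne_zero_le : ∀ i, M.orbit v i ≠ 0 → d ≤ i := fun i hi =>
    le_of_not_gt fun h => hi (hd i h _)
  by_cases hfin : ∃ i, d ≤ i ∧ M.orbit v i = 0
  · obtain ⟨n, ⟨hn, hn0⟩, hmin⟩ := Int.exists_least_of_bdd ⟨d, fun i hi => hi.1⟩ hfin
    have hdn : d < n := lt_of_le_of_ne hn fun h => hv (by subst h; rwa [orbit_self] at hn0)
    refine ⟨((-n : ℤ) : Zb), ((-d : ℤ) : Zb), by exact_mod_cast neg_lt_neg hdn, fun i => ?_⟩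
    rw [WithBot.coe_lt_coe, WithBot.coe_le_coe]
    constructor
    · rintro ⟨h₁, h₂⟩ h
      have := hmin i ⟨by omega, h⟩
      omega
    · intro h
      have hi := ne_zero_le i h
      refine ⟨neg_lt_neg (lt_of_not_ge fun hle => ?_), by omega⟩
      exact orbit_ne_zero_of_le M v hn hle h hn0
  · push Not at hfin
    refine ⟨⊥, ((-d : ℤ) : Zb), WithBot.bot_lt_coe _, fun i => ?_⟩
    rw [WithBot.coe_le_coe]
    refine ⟨fun h => hfin i (by omega), fun h => ⟨WithBot.bot_lt_coe _, ?_⟩⟩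
    have := ne_zero_le i h
    omega

variable {k} in
theorem GrIndec.exists_grIso_arcMod {M : GrMod k} (hfg : GrFG k M) (hM : GrIndec k M) :
    ∃ a b : Zb, a < b ∧ Nonempty (GrIso k M (arcMod k a b)) := by
  obtain ⟨hne, hind⟩ := hM
  obtain ⟨m, hm⟩ := hfg.exists_forall_lt_eq_zero
  obtain ⟨d, ⟨v, hv⟩, hmin⟩ := Int.exists_least_of_bdd (P := fun i => ∃ x : M.V i, x ≠ 0)
    ⟨m, fun i ⟨x, hx⟩ => le_of_not_gt fun h => hx (hm i h x)⟩ hne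
  have hd : ∀ i < d, ∀ x : M.V i, x = 0 := fun i hi x =>
    by_contra fun hx => not_le.2 hi (hmin i ⟨x, hx⟩)
  obtain ⟨r, hr1, hr0, hract⟩ := M.exists_retraction v hv hd
  let P : SubRep k M :=
    { P := fun i => k ∙ M.orbit v i
      act_mem := fun i x hx => by
        obtain ⟨c, rfl⟩ := Submodule.mem_span_singleton.1 hx
        by_cases h : d ≤ i
        · rw [map_smul, M.act_orbit v h]
          exact Submodule.smul_mem _ _ (Submodule.mem_span_singleton_self _)
        · rw [hd i (not_le.1 h) (c • _), map_zero]
          exact zero_mem _ }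
  let Q : SubRep k M :=
    { P := fun i => LinearMap.ker (r i)
      act_mem := fun i x hx => by
        rw [LinearMap.mem_ker] at hx ⊢
        by_cases h : M.orbit v (i + 1) = 0
        · rw [hr0 _ h, LinearMap.zero_apply]
        · rw [hract i h, hx] }
  have hcompl : ∀ i, IsCompl (P.P i) (Q.P i) := by
    intro i
    by_cases h : M.orbit v i = 0
    · simp [P, Q, h, hr0 i h, isCompl_bot_top]
    · have hne : r i (M.orbit v i) ≠ 0 := by rw [hr1 i h]; exact one_ne_zero
      refine ⟨Submodule.disjoint_def.2 fun x hx hxQ => ?_,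
        codisjoint_iff.2 ((r i).span_singleton_sup_ker_eq_top hne)⟩
      obtain ⟨c, rfl⟩ := Submodule.mem_span_singleton.1 hx
      have hc : c = 0 := by simpa [Q, hr1 i h] using hxQ
      rw [hc, zero_smul]
  have hker : ∀ i, LinearMap.ker (r i) = ⊥ := by
    by_contra! hQ
    refine hind ⟨P, Q, ⟨d, ?_⟩, hQ, hcompl⟩
    rw [Submodule.span_singleton_eq_bot.ne, M.orbit_self]
    exact hv
  obtain ⟨a, b, hab, hsupp⟩ := M.exists_arc_orbit v hv hd
  have hmem : ∀ i x, r i x ∈ arcComp k a b i := by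
    intro i x
    rw [mem_arcComp, hsupp]
    by_cases h : M.orbit v i = 0
    · exact Or.inl (by rw [hr0 i h, LinearMap.zero_apply])
    · exact Or.inr h
  refine ⟨a, b, hab, ⟨⟨fun i => LinearEquiv.ofBijective
    ((r i).codRestrict (arcComp k a b i) (hmem i)) ⟨?_, ?_⟩, fun i x => ?_⟩⟩⟩
  · rw [← LinearMap.ker_eq_bot, LinearMap.ker_codRestrict, hker]
  · rintro ⟨c, hc⟩
    rw [mem_arcComp, hsupp] at hc
    rcases hc with rfl | h
    · exact ⟨0, Subtype.ext (map_zero _)⟩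
    · exact ⟨c • M.orbit v i, Subtype.ext (by simp [hr1 i h])⟩
  · let y : arcComp k a b i := ⟨r i x, hmem i x⟩
    by_cases h : M.orbit v (i + 1) = 0
    · have htop : arcComp k a b (i + 1) ≠ ⊤ := by
        rw [Ne, arcComp_eq_top_iff, hsupp]
        exact not_not.2 h
      have hr : r (i + 1) (M.act i x) = 0 := by rw [hr0 _ h, LinearMap.zero_apply]
      exact (LinearMap.congr_fun (arcMod_act_eq_zero k htop) y).trans (Subtype.ext hr.symm)
    · have htop : arcComp k a b (i + 1) = ⊤ := by rwa [arcComp_eq_top_iff, hsupp]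
      exact Subtype.ext ((arcMod_act_coe k htop y).trans (hract i h x).symm)

variable {k} in
/-- The inverse of an isomorphism of graded modules. -/
def GrIso.symm {M N : GrMod k} (e : GrIso k M N) : GrIso k N M where
  e i := (e.e i).symm
  comm i x := by rw [LinearEquiv.eq_symm_apply, ← e.comm, LinearEquiv.apply_symm_apply]

variable {k} in
theorem GrIso.mem_arc_of_mem_arc {a b a' b' : Zb} (e : GrIso k (arcMod k a b) (arcMod k a' b'))
    {z : ℤ} (hz : a < (z : Zb) ∧ (z : Zb) ≤ b) : a' < (z : Zb) ∧ (z : Zb) ≤ b' := by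
  rw [← neg_neg z] at hz ⊢
  let x : arcComp k a b (-z) := ⟨1, (mem_arcComp k).2 (Or.inr hz)⟩
  have hx : e.e (-z) x ≠ 0 := (e.e (-z)).map_ne_zero_iff.2 fun h =>
    one_ne_zero (congrArg (arcComp k a b (-z)).subtype h)
  let w : arcComp k a' b' (-z) := e.e (-z) x
  exact ((mem_arcComp k).1 w.2).resolve_left fun h => hx (Subtype.ext h)

/-- An arc is determined by the integers it covers. -/
theorem Zb.arc_ext {a b a' b' : Zb} (hab : a < b) (hab' : a' < b')
    (h : ∀ z : ℤ, (a < (z : Zb) ∧ (z : Zb) ≤ b) ↔ (a' < (z : Zb) ∧ (z : Zb) ≤ b')) :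
    a = a' ∧ b = b' := by
  obtain ⟨n, rfl⟩ := WithBot.ne_bot_iff_exists.1 hab.ne_bot
  obtain ⟨n', rfl⟩ := WithBot.ne_bot_iff_exists.1 hab'.ne_bot
  have hb : (n : Zb) = n' :=
    le_antisymm ((h n).1 ⟨hab, le_rfl⟩).2 ((h n').2 ⟨hab', le_rfl⟩).2
  refine ⟨le_antisymm (le_of_not_gt fun hlt => ?_) (le_of_not_gt fun hlt => ?_), hb⟩
  · obtain ⟨m, rfl⟩ := WithBot.ne_bot_iff_exists.1 hlt.ne_bot
    exact lt_irrefl _ ((h m).2 ⟨hlt, hab.le.trans hb.le⟩).1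
  · obtain ⟨m, rfl⟩ := WithBot.ne_bot_iff_exists.1 hlt.ne_bot
    exact lt_irrefl _ ((h m).1 ⟨hlt, hab'.le.trans hb.ge⟩).1

/-- Every nonzero finitely generated indecomposable `ℤ`-graded module over
`S = k[y]` is isomorphic, via a degree-preserving isomorphism, to `M_{(a,b)}` for some arc
`(a,b)` (i.e. to `S(j)` for the arc `(−∞,j)`, or to `S/(y^i)(j)` for the arc `(j−i,j)`);
moreover modules corresponding to distinct arcs are not isomorphic, so the isomorphism
classes of finitely generated indecomposable graded `S`-modules are in bijection with the
arcs. -/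
theorem stmt17 :
    (∀ M : GrMod k, GrFG k M → GrIndec k M →
      ∃ a b : Zb, a < b ∧ Nonempty (GrIso k M (arcMod k a b))) ∧
    (∀ a b a' b' : Zb, a < b → a' < b' →
      Nonempty (GrIso k (arcMod k a b) (arcMod k a' b')) → a = a' ∧ b = b') :=
  ⟨fun _ hfg hM => hM.exists_grIso_arcMod hfg, fun _ _ _ _ hab hab' ⟨e⟩ =>
    Zb.arc_ext hab hab' fun _ => ⟨e.mem_arc_of_mem_arc, e.symm.mem_arc_of_mem_arc⟩⟩
end

section
/- Let 𝒮 ⊆ 𝒜 be a saturated set of arcs. Then the relation ∼ on 𝒵 = ℤ ∪ {−∞} defined by a ∼ b iff a = b, or (a,b) ∈ 𝒮, or (b,a) ∈ 𝒮, is an equivalence relation. Equivalently, setting φ(𝒮)(a) = {a} ∪ { b ∈ 𝒵 : (a,b) ∈ 𝒮 or (b,a) ∈ 𝒮 }, one has b ∈ φ(𝒮)(a) if and only if φ(𝒮)(a) = φ(𝒮)(b). -/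
/-- The set `𝒜` of arcs: pairs `(a,b)` with `a < b` in `𝒵`. -/
def ArcSet : Set (Zb × Zb) := {p | p.1 < p.2}

/-- The set `𝒜_f` of arcs of finite length: arcs `(a,b)` with `a ∈ ℤ`. -/
def FinArcSet : Set (Zb × Zb) := {p | ⊥ < p.1 ∧ p.1 < p.2}

/-- A set of arcs `𝒮` is saturated if whenever `(a,b), (c,d) ∈ 𝒮` touch with
`a ≤ c ≤ b ≤ d`, each of `(a,c), (c,b), (b,d), (a,d)` which is an arc lies in `𝒮`. -/
def Saturated (S : Set (Zb × Zb)) : Prop :=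
  ∀ ⦃a b c d : Zb⦄, (a, b) ∈ S → (c, d) ∈ S → a ≤ c → c ≤ b → b ≤ d →
    (a < c → (a, c) ∈ S) ∧ (c < b → (c, b) ∈ S) ∧
    (b < d → (b, d) ∈ S) ∧ (a < d → (a, d) ∈ S)

/-- The saturation of a set of arcs: the smallest saturated subset of `𝒜` containing it. -/
def satClosure (U : Set (Zb × Zb)) : Set (Zb × Zb) :=
  ⋂₀ {S | U ⊆ S ∧ S ⊆ ArcSet ∧ Saturated S}

/-- A partition of a poset is non-crossing if whenever `a, b` lie in a common block and `c, d`
lie in a common block different from that of `a` and `b`, neither `a < c < b < d` nor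
`c < a < d < b` holds. -/
def NonCrossing {Z : Type*} [PartialOrder Z] (P : Set (Set Z)) : Prop :=
  ∀ B₁ ∈ P, ∀ B₂ ∈ P, B₁ ≠ B₂ → ∀ a ∈ B₁, ∀ b ∈ B₁, ∀ c ∈ B₂, ∀ d ∈ B₂,
    ¬(a < c ∧ c < b ∧ b < d) ∧ ¬(c < a ∧ a < d ∧ d < b)

/-- `α(B)`: the set of arcs whose endpoints lie in a common block of `B`. -/
def alphaMap (P : Set (Set Zb)) : Set (Zb × Zb) :=
  {p | p.1 < p.2 ∧ ∃ B ∈ P, p.1 ∈ B ∧ p.2 ∈ B}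

/-- `φ(𝒮)(a)`: the block of `a` determined by a saturated set of arcs `𝒮`. -/
def phiBlock (S : Set (Zb × Zb)) (a : Zb) : Set Zb :=
  insert a {b | (a, b) ∈ S ∨ (b, a) ∈ S}

/-- `φ(𝒮)`: the partition of `𝒵` determined by a saturated set of arcs `𝒮`. -/
def phiMap (S : Set (Zb × Zb)) : Set (Set Zb) :=
  {B | ∃ a : Zb, B = phiBlock S a}

/-- Arcs `(a,b)` and `(b,c)` of a saturated set compose to `(a,c)`. -/
theorem Saturated.comp_mem {S : Set (Zb × Zb)} (hsat : Saturated S) (hS : S ⊆ ArcSet)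
    {a b c : Zb} (hab : (a, b) ∈ S) (hbc : (b, c) ∈ S) : (a, c) ∈ S :=
  have hlt : a < b := hS hab
  have hlt' : b < c := hS hbc
  (hsat hab hbc hlt.le le_rfl hlt'.le).2.2.2 (hlt.trans hlt')

/-- Two arcs of a saturated set with the same left endpoint have related right endpoints. -/
theorem Saturated.right_related {S : Set (Zb × Zb)} (hsat : Saturated S) (hS : S ⊆ ArcSet)
    {a b c : Zb} (hab : (a, b) ∈ S) (hac : (a, c) ∈ S) :
    b = c ∨ (b, c) ∈ S ∨ (c, b) ∈ S := by
  have hlt : a < b := hS hab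
  have hlt' : a < c := hS hac
  rcases lt_trichotomy b c with h | h | h
  · exact .inr (.inl ((hsat hab hac le_rfl hlt.le h.le).2.2.1 h))
  · exact .inl h
  · exact .inr (.inr ((hsat hac hab le_rfl hlt'.le h.le).2.2.1 h))

/-- Two arcs of a saturated set with the same right endpoint have related left endpoints. -/
theorem Saturated.left_related {S : Set (Zb × Zb)} (hsat : Saturated S) (hS : S ⊆ ArcSet)
    {a b c : Zb} (hac : (a, c) ∈ S) (hbc : (b, c) ∈ S) :
    a = b ∨ (a, b) ∈ S ∨ (b, a) ∈ S := by
  have hlt : a < c := hS hac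
  have hlt' : b < c := hS hbc
  rcases lt_trichotomy a b with h | h | h
  · exact .inr (.inl ((hsat hac hbc h.le hlt'.le le_rfl).1 h))
  · exact .inl h
  · exact .inr (.inr ((hsat hbc hac h.le hlt.le le_rfl).1 h))

/-- The relation of being equal or joined by an arc of a saturated set is an equivalence. -/
theorem Saturated.equivalence {S : Set (Zb × Zb)} (hsat : Saturated S) (hS : S ⊆ ArcSet) :
    Equivalence (fun a b : Zb => a = b ∨ (a, b) ∈ S ∨ (b, a) ∈ S) where
  refl _ := .inl rfl
  symm := by
    rintro a b (h | h | h)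
    · exact .inl h.symm
    · exact .inr (.inr h)
    · exact .inr (.inl h)
  trans := by
    rintro a b c (rfl | hab | hba) (rfl | hbc | hcb)
    · exact .inl rfl
    · exact .inr (.inl hbc)
    · exact .inr (.inr hcb)
    · exact .inr (.inl hab)
    · exact .inr (.inl (hsat.comp_mem hS hab hbc))
    · exact hsat.left_related hS hab hcb
    · exact .inr (.inr hba)
    · exact hsat.right_related hS hba hbc
    · exact .inr (.inr (hsat.comp_mem hS hcb hba))

theorem mem_phiBlock {S : Set (Zb × Zb)} {a b : Zb} :
    b ∈ phiBlock S a ↔ a = b ∨ (a, b) ∈ S ∨ (b, a) ∈ S := by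
  rw [eq_comm]
  rfl

/-- For a saturated set of arcs `𝒮`, the relation `a ∼ b` iff `a = b` or
`(a,b) ∈ 𝒮` or `(b,a) ∈ 𝒮` is an equivalence relation on `𝒵`; equivalently,
`b ∈ φ(𝒮)(a)` iff `φ(𝒮)(a) = φ(𝒮)(b)`. -/
theorem stmt19 (S : Set (Zb × Zb)) (hS : S ⊆ ArcSet) (hsat : Saturated S) :
    Equivalence (fun a b : Zb => a = b ∨ (a, b) ∈ S ∨ (b, a) ∈ S) ∧
    (∀ a b : Zb, b ∈ phiBlock S a ↔ phiBlock S a = phiBlock S b) := by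
  have heqv := hsat.equivalence hS
  refine ⟨heqv, fun a b => ⟨fun h => ?_, fun h => h ▸ mem_phiBlock.2 (.inl rfl)⟩⟩
  have hab := mem_phiBlock.1 h
  ext c
  rw [mem_phiBlock, mem_phiBlock]
  exact ⟨heqv.trans (heqv.symm hab), heqv.trans hab⟩
end
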